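/- Let A ∈ ℝ^{m×(nN)}, let α₁, …, α_N > 0, let 𝛂 := diag(α₁,…,α_N) ⊗ I_n, and let γ > 0. If γ < 1/(‖A‖²·α_max), where α_max := max_i αᵢ and ‖A‖ is the largest singular value of A, then the symmetric block matrix Φ_s := [[𝛂⁻¹, −Aᵀ], [−A, γ⁻¹ I_m]] is positive definite. -/

import Mathlib

open Matrix
open scoped Kronecker

/-- The maximum singular value (Euclidean operator norm) of a matrix. -/
noncomputable def opNorm {I J : Type*} [Fintype I] [Fintype J] [DecidableEq J]
    (A : Matrix I J ℝ) : ℝ :=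
  ‖LinearMap.toContinuousLinearMap (Matrix.toEuclideanLin A)‖

lemma dotProduct_self_eq_norm_toLp_sq {I : Type*} [Fintype I] (x : I → ℝ) :
    x ⬝ᵥ x = ‖WithLp.toLp 2 x‖ ^ 2 := by
  rw [EuclideanSpace.real_norm_sq_eq]
  simp [dotProduct, sq]

lemma dotProduct_mulVec_le_opNorm {I J : Type*} [Fintype I] [Fintype J] [DecidableEq J]
    (A : Matrix I J ℝ) (x : J → ℝ) (y : I → ℝ) :
    y ⬝ᵥ (A *ᵥ x) ≤ opNorm A * ‖WithLp.toLp 2 x‖ * ‖WithLp.toLp 2 y‖ := by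
  have hA : ‖WithLp.toLp 2 (A *ᵥ x)‖ ≤ opNorm A * ‖WithLp.toLp 2 x‖ :=
    (LinearMap.toContinuousLinearMap (Matrix.toEuclideanLin A)).le_opNorm (WithLp.toLp 2 x)
  have hinner : y ⬝ᵥ (A *ᵥ x) = inner ℝ (WithLp.toLp 2 (A *ᵥ x)) (WithLp.toLp 2 y) := by
    simp [EuclideanSpace.inner_eq_star_dotProduct]
  rw [hinner]
  exact (real_inner_le_norm _ _).trans (mul_le_mul_of_nonneg_right hA (norm_nonneg _))

lemma quadratic_form_pos {a c g X Y : ℝ} (ha : 0 < a) (hg : 0 < g) (hc : c ^ 2 * a * g < 1)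
    (h : X ≠ 0 ∨ Y ≠ 0) : 0 < a⁻¹ * X ^ 2 - 2 * (c * X * Y) + g⁻¹ * Y ^ 2 := by
  have hsq : a⁻¹ * X ^ 2 - 2 * (c * X * Y) + g⁻¹ * Y ^ 2
      = a⁻¹ * (X - c * a * Y) ^ 2 + g⁻¹ * (1 - c ^ 2 * a * g) * Y ^ 2 := by
    field_simp
    ring
  have hc' : 0 < 1 - c ^ 2 * a * g := sub_pos.2 hc
  rw [hsq]
  by_cases hY : Y = 0
  · have hX : X ≠ 0 := h.resolve_right (not_not.2 hY)
    subst hY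
    simp only [mul_zero, sub_zero]
    positivity
  · positivity

lemma inv_diagonal_kronecker_one {I J : Type*} [Fintype I] [Fintype J] [DecidableEq I]
    [DecidableEq J] {α : I → ℝ} (hα : ∀ i, α i ≠ 0) :
    (Matrix.diagonal α ⊗ₖ (1 : Matrix J J ℝ))⁻¹ = Matrix.diagonal fun p => (α p.1)⁻¹ := by
  apply Matrix.inv_eq_right_inv
  rw [← Matrix.diagonal_one, Matrix.diagonal_kronecker_diagonal, Matrix.diagonal_mul_diagonal]
  simp [hα]

lemma posDef_fromBlocks_diagonal {I J : Type*} [Fintype I] [Fintype J] [DecidableEq I]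
    [DecidableEq J] (A : Matrix I J ℝ) {d : J → ℝ} {a g : ℝ} (ha : 0 < a) (hg : 0 < g)
    (hd : ∀ j, a⁻¹ ≤ d j) (hA : opNorm A ^ 2 * a * g < 1) :
    (Matrix.fromBlocks (Matrix.diagonal d) (-Aᵀ) (-A) (g⁻¹ • (1 : Matrix I I ℝ))).PosDef := by
  refine Matrix.PosDef.of_dotProduct_mulVec_pos ?_ fun v hv => ?_
  · apply Matrix.IsHermitian.fromBlocks
    · simp [Matrix.IsHermitian]
    · simp [Matrix.conjTranspose_eq_transpose_of_trivial]
    · simp [Matrix.IsHermitian]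
  obtain ⟨x, y, rfl⟩ : ∃ x y, v = Sum.elim x y := ⟨_, _, (Sum.elim_comp_inl_inr v).symm⟩
  have hdiag : a⁻¹ * ‖WithLp.toLp 2 x‖ ^ 2 ≤ x ⬝ᵥ (Matrix.diagonal d *ᵥ x) := by
    rw [← dotProduct_self_eq_norm_toLp_sq]
    simp only [dotProduct, Matrix.mulVec_diagonal, Finset.mul_sum]
    refine Finset.sum_le_sum fun j _ => ?_
    nlinarith [mul_le_mul_of_nonneg_right (hd j) (mul_self_nonneg (x j))]
  have hform : star (Sum.elim x y) ⬝ᵥ (Matrix.fromBlocks (Matrix.diagonal d) (-Aᵀ) (-A)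
      (g⁻¹ • (1 : Matrix I I ℝ)) *ᵥ Sum.elim x y)
      = x ⬝ᵥ (Matrix.diagonal d *ᵥ x) - 2 * (y ⬝ᵥ (A *ᵥ x))
        + g⁻¹ * ‖WithLp.toLp 2 y‖ ^ 2 := by
    have hT : x ⬝ᵥ (Aᵀ *ᵥ y) = y ⬝ᵥ (A *ᵥ x) := by
      rw [Matrix.mulVec_transpose, dotProduct_comm, Matrix.dotProduct_mulVec]
    rw [← dotProduct_self_eq_norm_toLp_sq, star_trivial, Matrix.fromBlocks_mulVec]
    simp only [Sum.elim_comp_inl, Sum.elim_comp_inr, sumElim_dotProduct_sumElim,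
      dotProduct_add, Matrix.neg_mulVec, dotProduct_neg, Matrix.smul_mulVec, Matrix.one_mulVec,
      dotProduct_smul, smul_eq_mul, hT]
    ring
  have hne : ‖WithLp.toLp 2 x‖ ≠ 0 ∨ ‖WithLp.toLp 2 y‖ ≠ 0 := by
    by_contra! h
    simp only [norm_eq_zero, WithLp.toLp_eq_zero] at h
    exact hv (by rw [h.1, h.2]; exact Sum.elim_zero_zero)
  rw [hform]
  linarith [quadratic_form_pos ha hg hA hne, dotProduct_mulVec_le_opNorm A x y]

/-- if `γ < 1/(‖A‖² α_max)`, then the symmetric preconditioning matrix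
`Φ_s = [[alp⁻¹, −Aᵀ], [−A, γ⁻¹ I_m]]`, with `alp = diag(α) ⊗ I_n`, is positive definite. -/
theorem preconditioning_matrix_posdef
    (m n N : ℕ) (A : Matrix (Fin m) (Fin N × Fin n) ℝ)
    (α : Fin N → ℝ) (hα : ∀ i, 0 < α i) (γ : ℝ) (hγ : 0 < γ)
    (αmax : ℝ) (hαmax : IsGreatest (Set.range α) αmax)
    (hstep : γ < 1 / (opNorm A ^ 2 * αmax))
    (alp : Matrix (Fin N × Fin n) (Fin N × Fin n) ℝ)
    (halp : alp = (Matrix.diagonal α) ⊗ₖ (1 : Matrix (Fin n) (Fin n) ℝ)) :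
    (Matrix.fromBlocks alp⁻¹ (-Aᵀ) (-A) (γ⁻¹ • (1 : Matrix (Fin m) (Fin m) ℝ))).PosDef := by
  obtain ⟨⟨i₀, hi₀⟩, hub⟩ := hαmax
  have hmax : 0 < αmax := hi₀ ▸ hα i₀
  have hA : opNorm A ^ 2 * αmax * γ < 1 := by
    have hpos : 0 < opNorm A ^ 2 * αmax := one_div_pos.1 (hγ.trans hstep)
    rwa [lt_div_iff₀ hpos, mul_comm] at hstep
  rw [halp, inv_diagonal_kronecker_one fun i => (hα i).ne']
  exact posDef_fromBlocks_diagonal A hmax hγ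
    (fun p => inv_anti₀ (hα p.1) (hub ⟨p.1, rfl⟩)) hA
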